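/- Assume p is Lipschitz in z with constant K¹ > 0 and ℓ is Lipschitz in z with constant K² > 0 and bounded by L (as in the context), and set K³ := |𝒳|·(1+K¹) and K⁴ := |𝒳|·(L+K²). Let W, Ŵ : Δ(𝒳) → ℝ≥0 be such that |W(m) − Ŵ(z)| ≤ K·‖m−z‖∞ + ε for all m, z ∈ Δ(𝒳), for some constants K, ε ≥ 0. For n ≥ 1 define V(m) := min_{γ∈𝒢} ( ĉ(m,γ) + Σ_{𝐰∈𝒲ⁿ} (Π_{i=1}^n P_W(wⁱ))·W(f̄(m,γ,𝐰)) ) and V̂(z) := min_{γ∈𝒢} ( ĉ(z,γ) + Ŵ(f̂(z,γ)) ). Then for all m, z ∈ Δ(𝒳): |V(m) − V̂(z)| ≤ (K⁴ + K·K³)·‖m − z‖∞ + ε + K·|𝒳|·|𝒲|/√n. -/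

import Mathlib

open Finset

noncomputable section

variable {X U W : Type*}

/-- `z ∈ I(𝒳)`: componentwise in `[0,1]`. -/
def inI (z : X → ℝ) : Prop := ∀ x, 0 ≤ z x ∧ z x ≤ 1

/-- `z ∈ Δ(𝒳)`: the probability simplex on `X`. -/
def inDelta [Fintype X] (z : X → ℝ) : Prop := inI z ∧ ∑ x, z x = 1

/-- `m ∈ M_n`: empirical distributions of `n` points. -/
def inMn [Fintype X] (n : ℕ) (m : X → ℝ) : Prop :=
  inDelta m ∧ ∀ x, ∃ k : ℤ, (n : ℝ) * m x = (k : ℝ)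

/-- transition kernel `p(y|x,u,z) = Σ_w 1(f(x,u,z,w)=y)·P_W(w)`. -/
def ker [DecidableEq X] [Fintype W] (f : X → U → (X → ℝ) → W → X) (Pw : W → ℝ)
    (y x : X) (u : U) (z : X → ℝ) : ℝ :=
  ∑ w, if f x u z w = y then Pw w else 0

/-- deterministic mean-field update `f̂(z,γ)(y) = Σ_x z(x)·p(y|x,γ(x),z)`. -/
def fhat [Fintype X] [DecidableEq X] [Fintype W] (f : X → U → (X → ℝ) → W → X)
    (Pw : W → ℝ) (z : X → ℝ) (γ : X → U) : X → ℝ :=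
  fun y => ∑ x, z x * ker f Pw y x (γ x) z

/-- expected per-step cost `ĉ(z,γ) = Σ_x z(x)·ℓ(x,γ(x),z)`. -/
def chat [Fintype X] (ℓ : X → U → (X → ℝ) → ℝ) (z : X → ℝ) (γ : X → U) : ℝ :=
  ∑ x, z x * ℓ x (γ x) z

/-- empirical distribution of `n` points of `X`. -/
def emp [Fintype X] [DecidableEq X] {n : ℕ} (x : Fin n → X) : X → ℝ :=
  fun y => (1 / (n : ℝ)) * ∑ i, if x i = y then (1 : ℝ) else 0

/-- empirical distribution of the noise vector `ω`. -/
def ehat [DecidableEq W] {n : ℕ} (ω : Fin n → W) (w : W) : ℝ :=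
  (1 / (n : ℝ)) * ∑ i, if ω i = w then (1 : ℝ) else 0

/-- empirical mean-field update
`f̄(m,γ,𝐰)(y) = Σ_x Σ_w 1(f(x,γ(x),m,w)=y)·m(x)·ê_𝐰(w)`. -/
def fbar [Fintype X] [DecidableEq X] [Fintype W] [DecidableEq W] {n : ℕ}
    (f : X → U → (X → ℝ) → W → X) (m : X → ℝ) (γ : X → U) (ω : Fin n → W) : X → ℝ :=
  fun y => ∑ x, ∑ w, (if f x (γ x) m w = y then (1 : ℝ) else 0) * m x * ehat ω w

lemma aux_iInf {ι : Type*} [Finite ι] [Nonempty ι] (a b : ι → ℝ) (C : ℝ)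
    (h : ∀ i, |a i - b i| ≤ C) : |(⨅ i, a i) - (⨅ i, b i)| ≤ C := by
  obtain ⟨i, hi⟩ := exists_eq_ciInf_of_finite (f := a)
  obtain ⟨j, hj⟩ := exists_eq_ciInf_of_finite (f := b)
  have h1 : (⨅ i, a i) ≤ a j := ciInf_le (Set.finite_range a).bddBelow j
  have h2 : (⨅ i, b i) ≤ b i := ciInf_le (Set.finite_range b).bddBelow i
  have h3 := abs_le.1 (h i)
  have h4 := abs_le.1 (h j)
  rw [abs_le]
  constructor <;> linarith [h3.1, h3.2, h4.1, h4.2]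

lemma aux_prod [Fintype W] {n : ℕ} (g : Fin n → W → ℝ) :
    ∑ ω : Fin n → W, ∏ i, g i (ω i) = ∏ i, ∑ w, g i w := by
  classical
  rw [Finset.prod_univ_sum, Fintype.piFinset_univ]

lemma aux_tot [Fintype W] (Pw : W → ℝ) (h1 : ∑ w, Pw w = 1) (n : ℕ) :
    ∑ ω : Fin n → W, ∏ i, Pw (ω i) = 1 := by
  rw [aux_prod (fun _ => Pw)]; simp [h1]

lemma aux_cross [Fintype W] (Pw a : W → ℝ) (ha : ∑ w, Pw w * a w = 0) {n : ℕ}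
    (i j : Fin n) (hij : i ≠ j) :
    ∑ ω : Fin n → W, (∏ k, Pw (ω k)) * (a (ω i) * a (ω j)) = 0 := by
  have e : ∀ ω : Fin n → W, (∏ k, Pw (ω k)) * (a (ω i) * a (ω j)) =
      ∏ k, (Pw (ω k) * ((if k = i then a (ω k) else 1) * (if k = j then a (ω k) else 1))) := by
    intro ω
    rw [Finset.prod_mul_distrib, Finset.prod_mul_distrib]
    simp [Finset.prod_ite_eq']
  rw [Finset.sum_congr rfl (fun ω _ => e ω)]
  rw [aux_prod (fun k w => Pw w * ((if k = i then a w else 1) * (if k = j then a w else 1)))]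
  apply Finset.prod_eq_zero (Finset.mem_univ i)
  simp [hij, ha]

lemma aux_sq [Fintype W] (Pw a : W → ℝ) (h0 : ∀ w, 0 ≤ Pw w) (h1 : ∑ w, Pw w = 1)
    (ha : ∑ w, Pw w * a w = 0) (hb : ∀ w, |a w| ≤ 1) (n : ℕ) :
    ∑ ω : Fin n → W, (∏ k, Pw (ω k)) * (∑ i, a (ω i)) ^ 2 ≤ n := by
  have e : ∑ ω : Fin n → W, (∏ k, Pw (ω k)) * (∑ i, a (ω i)) ^ 2 =
      ∑ i : Fin n, ∑ j : Fin n, ∑ ω : Fin n → W, (∏ k, Pw (ω k)) * (a (ω i) * a (ω j)) := by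
    simp_rw [sq, Finset.sum_mul_sum, Finset.mul_sum]
    rw [Finset.sum_comm]
    refine Finset.sum_congr rfl fun i _ => ?_
    rw [Finset.sum_comm]
  rw [e]
  calc _ ≤ ∑ i : Fin n, (1 : ℝ) := by
        refine Finset.sum_le_sum fun i _ => ?_
        rw [Finset.sum_eq_single i (fun j _ hj => aux_cross Pw a ha i j hj.symm) (by simp)]
        rw [← aux_tot Pw h1 n]
        refine Finset.sum_le_sum fun ω _ => ?_
        refine mul_le_of_le_one_right (Finset.prod_nonneg fun k _ => h0 _) ?_
        have := abs_le.1 (hb (ω i))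
        nlinarith [this.1, this.2]
    _ = n := by simp

lemma aux_alg (s t : ℝ) (hs : 0 < s) :
    t ^ 2 * (1 / (2 * (s * s) * s)) + 1 / (2 * s) - t / (s * s)
      = (t - s) ^ 2 / (2 * (s * s) * s) := by
  field_simp
  ring

lemma aux_dev [Fintype W] [DecidableEq W] (Pw : W → ℝ) (h0 : ∀ w, 0 ≤ Pw w)
    (h1 : ∑ w, Pw w = 1) (n : ℕ) (hn : 1 ≤ n) (w : W) :
    ∑ ω : Fin n → W, (∏ k, Pw (ω k)) * |ehat ω w - Pw w| ≤ 1 / Real.sqrt n := by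
  have hn' : (0 : ℝ) < n := by exact_mod_cast hn
  have hs : 0 < Real.sqrt n := Real.sqrt_pos.2 hn'
  have hss : Real.sqrt n * Real.sqrt n = n := Real.mul_self_sqrt hn'.le
  have hle : Pw w ≤ 1 := by
    rw [← h1]; exact Finset.single_le_sum (fun v _ => h0 v) (Finset.mem_univ w)
  set a : W → ℝ := fun v => (if v = w then 1 else 0) - Pw w with hadef
  have ha : ∑ v, Pw v * a v = 0 := by
    simp [hadef, mul_sub, Finset.sum_sub_distrib, ← Finset.sum_mul, h1]
  have hb : ∀ v, |a v| ≤ 1 := by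
    intro v
    have := h0 w
    simp only [hadef]
    rw [abs_le]
    split_ifs <;> constructor <;> linarith
  have hsq := aux_sq Pw a h0 h1 ha hb n
  have e : ∀ ω : Fin n → W, ehat ω w - Pw w = (∑ i, a (ω i)) / n := by
    intro ω
    simp only [ehat, hadef, Finset.sum_sub_distrib, Finset.sum_const, Finset.card_univ,
      Fintype.card_fin, nsmul_eq_mul]
    field_simp
  have key : ∀ ω : Fin n → W, |ehat ω w - Pw w| ≤
      (∑ i, a (ω i)) ^ 2 * (1 / (2 * n * Real.sqrt n)) + 1 / (2 * Real.sqrt n) := by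
    intro ω
    rw [e ω, abs_div, abs_of_pos hn', ← sq_abs]
    generalize |∑ i, a (ω i)| = t
    have : t ^ 2 * (1 / (2 * n * Real.sqrt n)) + 1 / (2 * Real.sqrt n) - t / n
        = (t - Real.sqrt n) ^ 2 / (2 * n * Real.sqrt n) := by
      have q := aux_alg (Real.sqrt n) t hs
      rwa [hss] at q
    have : 0 ≤ (t - Real.sqrt n) ^ 2 / (2 * n * Real.sqrt n) := by positivity
    linarith
  calc _ ≤ ∑ ω : Fin n → W, (∏ k, Pw (ω k)) *
        ((∑ i, a (ω i)) ^ 2 * (1 / (2 * n * Real.sqrt n)) + 1 / (2 * Real.sqrt n)) :=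
        Finset.sum_le_sum fun ω _ =>
          mul_le_mul_of_nonneg_left (key ω) (Finset.prod_nonneg fun k _ => h0 _)
    _ = (∑ ω : Fin n → W, (∏ k, Pw (ω k)) * (∑ i, a (ω i)) ^ 2) * (1 / (2 * n * Real.sqrt n))
        + 1 / (2 * Real.sqrt n) := by
        simp_rw [mul_add, Finset.sum_add_distrib, ← mul_assoc, ← Finset.sum_mul]
        rw [aux_tot Pw h1 n, one_mul]
    _ ≤ n * (1 / (2 * n * Real.sqrt n)) + 1 / (2 * Real.sqrt n) := by gcongr
    _ = 1 / Real.sqrt n := by field_simp; ring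

lemma aux_ker_nonneg [DecidableEq X] [Fintype W] (f : X → U → (X → ℝ) → W → X) (Pw : W → ℝ)
    (h0 : ∀ w, 0 ≤ Pw w) (y x : X) (u : U) (z : X → ℝ) : 0 ≤ ker f Pw y x u z := by
  refine Finset.sum_nonneg fun w _ => ?_
  split_ifs <;> simp [h0]

lemma aux_ker_le [DecidableEq X] [Fintype W] (f : X → U → (X → ℝ) → W → X) (Pw : W → ℝ)
    (h0 : ∀ w, 0 ≤ Pw w) (h1 : ∑ w, Pw w = 1) (y x : X) (u : U) (z : X → ℝ) :
    ker f Pw y x u z ≤ 1 := by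
  rw [← h1]
  refine Finset.sum_le_sum fun w _ => ?_
  split_ifs <;> simp [h0]

lemma aux_delta [Fintype X] (z : X → ℝ) (h0 : ∀ x, 0 ≤ z x) (h1 : ∑ x, z x = 1) :
    inDelta z := by
  refine ⟨fun x => ⟨h0 x, ?_⟩, h1⟩
  rw [← h1]; exact Finset.single_le_sum (fun v _ => h0 v) (Finset.mem_univ x)

lemma aux_fhat_delta [Fintype X] [DecidableEq X] [Fintype W] (f : X → U → (X → ℝ) → W → X)
    (Pw : W → ℝ) (h0 : ∀ w, 0 ≤ Pw w) (h1 : ∑ w, Pw w = 1) (z : X → ℝ) (hz : inDelta z)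
    (γ : X → U) : inDelta (fhat f Pw z γ) := by
  apply aux_delta
  · intro y
    exact Finset.sum_nonneg fun x _ => mul_nonneg (hz.1 x).1 (aux_ker_nonneg f Pw h0 _ _ _ _)
  · simp only [fhat]
    rw [Finset.sum_comm]
    simp_rw [← Finset.mul_sum]
    rw [← hz.2]
    refine Finset.sum_congr rfl fun x _ => ?_
    simp only [ker]
    rw [Finset.sum_comm]
    simp [h1]

lemma aux_ehat_sum [Fintype W] [DecidableEq W] {n : ℕ} (hn : 1 ≤ n) (ω : Fin n → W) :
    ∑ w, ehat ω w = 1 := by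
  have hn' : (n : ℝ) ≠ 0 := by positivity
  simp only [ehat]
  rw [← Finset.mul_sum, Finset.sum_comm]
  simp [hn']

lemma aux_ehat_nonneg [DecidableEq W] {n : ℕ} (ω : Fin n → W) (w : W) : 0 ≤ ehat ω w := by
  unfold ehat
  refine mul_nonneg (by positivity) (Finset.sum_nonneg fun i _ => ?_)
  split_ifs <;> simp

lemma aux_fbar_delta [Fintype X] [DecidableEq X] [Fintype W] [DecidableEq W] {n : ℕ}
    (hn : 1 ≤ n) (f : X → U → (X → ℝ) → W → X) (z : X → ℝ) (hz : inDelta z)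
    (γ : X → U) (ω : Fin n → W) : inDelta (fbar f z γ ω) := by
  apply aux_delta
  · intro y
    refine Finset.sum_nonneg fun x _ => Finset.sum_nonneg fun w _ =>
      mul_nonneg (mul_nonneg ?_ (hz.1 x).1) (aux_ehat_nonneg _ _)
    split_ifs <;> simp
  · simp only [fbar]
    rw [Finset.sum_comm]
    refine Eq.trans ?_ hz.2
    refine Finset.sum_congr rfl fun x _ => ?_
    rw [Finset.sum_comm]
    simp_rw [← Finset.sum_mul]
    simp [← Finset.mul_sum, aux_ehat_sum hn ω]

/-- pointwise deviation bound -/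
lemma aux_fbar_fhat [Fintype X] [DecidableEq X] [Fintype W] [DecidableEq W] {n : ℕ}
    (f : X → U → (X → ℝ) → W → X) (Pw : W → ℝ) (z : X → ℝ) (hz : inDelta z)
    (γ : X → U) (ω : Fin n → W) :
    ‖fbar f z γ ω - fhat f Pw z γ‖ ≤ ∑ w, |ehat ω w - Pw w| := by
  rw [pi_norm_le_iff_of_nonneg (Finset.sum_nonneg fun w _ => abs_nonneg _)]
  intro y
  have e : (fbar f z γ ω - fhat f Pw z γ) y =
      ∑ x, z x * ∑ w, (if f x (γ x) z w = y then (1 : ℝ) else 0) * (ehat ω w - Pw w) := by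
    simp only [Pi.sub_apply, fbar, fhat, ker]
    rw [← Finset.sum_sub_distrib]
    refine Finset.sum_congr rfl fun x _ => ?_
    rw [Finset.mul_sum, Finset.mul_sum, ← Finset.sum_sub_distrib]
    refine Finset.sum_congr rfl fun w _ => ?_
    split_ifs <;> ring
  rw [e, Real.norm_eq_abs]
  calc _ ≤ ∑ x, |z x * ∑ w, (if f x (γ x) z w = y then (1 : ℝ) else 0) * (ehat ω w - Pw w)| :=
        Finset.abs_sum_le_sum_abs _ _
    _ ≤ ∑ x, z x * ∑ w, |ehat ω w - Pw w| := by
        refine Finset.sum_le_sum fun x _ => ?_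
        rw [abs_mul, abs_of_nonneg (hz.1 x).1]
        refine mul_le_mul_of_nonneg_left ?_ (hz.1 x).1
        refine (Finset.abs_sum_le_sum_abs _ _).trans (Finset.sum_le_sum fun w _ => ?_)
        split_ifs <;> simp
    _ = _ := by rw [← Finset.sum_mul, hz.2, one_mul]

lemma aux_lip [Fintype X] (m z g h : X → ℝ) (hz : inI z) (A B : ℝ)
    (hg : ∀ x, |g x| ≤ A) (hgh : ∀ x, |g x - h x| ≤ B * ‖m - z‖) :
    |∑ x, m x * g x - ∑ x, z x * h x| ≤ (Fintype.card X : ℝ) * (A + B) * ‖m - z‖ := by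
  rw [← Finset.sum_sub_distrib]
  refine (Finset.abs_sum_le_sum_abs _ _).trans ?_
  calc _ ≤ ∑ x : X, (A + B) * ‖m - z‖ := by
        refine Finset.sum_le_sum fun x _ => ?_
        have hd : |m x - z x| ≤ ‖m - z‖ := norm_le_pi_norm (m - z) x
        have e : m x * g x - z x * h x = (m x - z x) * g x + z x * (g x - h x) := by ring
        rw [e]
        refine (abs_add_le _ _).trans ?_
        rw [abs_mul, abs_mul, abs_of_nonneg (hz x).1]
        have h1 : |m x - z x| * |g x| ≤ ‖m - z‖ * A :=
          mul_le_mul hd (hg x) (abs_nonneg _) (norm_nonneg _)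
        have h2 : z x * |g x - h x| ≤ 1 * (B * ‖m - z‖) :=
          mul_le_mul (hz x).2 (hgh x) (abs_nonneg _) zero_le_one
        linarith
    _ = _ := by simp; ring

theorem stmt11 [Fintype X] [Nonempty X] [DecidableEq X] [Fintype U] [Nonempty U]
    [Fintype W] [Nonempty W] [DecidableEq W]
    (Pw : W → ℝ) (hPw0 : ∀ w, 0 ≤ Pw w) (hPw1 : ∑ w, Pw w = 1)
    (f : X → U → (X → ℝ) → W → X)
    (ℓ : X → U → (X → ℝ) → ℝ) (hℓ0 : ∀ x u z, inI z → 0 ≤ ℓ x u z)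
    (K1 K2 L : ℝ) (hK1 : 0 < K1) (hK2 : 0 < K2)
    (hpLip : ∀ (x y : X) (u : U) (z₁ z₂ : X → ℝ), inI z₁ → inI z₂ →
      |ker f Pw y x u z₁ - ker f Pw y x u z₂| ≤ K1 * ‖z₁ - z₂‖)
    (hℓLip : ∀ (x : X) (u : U) (z₁ z₂ : X → ℝ), inI z₁ → inI z₂ →
      |ℓ x u z₁ - ℓ x u z₂| ≤ K2 * ‖z₁ - z₂‖)
    (hℓBd : ∀ x u z, inI z → ℓ x u z ≤ L)
    (Wf What : (X → ℝ) → ℝ)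
    (hWf0 : ∀ m, inDelta m → 0 ≤ Wf m) (hWhat0 : ∀ z, inDelta z → 0 ≤ What z)
    (K ε : ℝ) (hK : 0 ≤ K) (hε : 0 ≤ ε)
    (hWW : ∀ m z : X → ℝ, inDelta m → inDelta z →
      |Wf m - What z| ≤ K * ‖m - z‖ + ε)
    (n : ℕ) (hn : 1 ≤ n) :
    ∀ m z : X → ℝ, inDelta m → inDelta z →
      |(⨅ γ : X → U, (chat ℓ m γ +
            ∑ ω : Fin n → W, (∏ i, Pw (ω i)) * Wf (fbar f m γ ω))) -
          (⨅ γ : X → U, (chat ℓ z γ + What (fhat f Pw z γ)))|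
        ≤ ((Fintype.card X : ℝ) * (L + K2) + K * ((Fintype.card X : ℝ) * (1 + K1))) *
              ‖m - z‖ +
            ε + K * (Fintype.card X : ℝ) * (Fintype.card W : ℝ) / Real.sqrt n := by
  intro m z hm hz
  apply aux_iInf
  intro γ
  have hX : (1 : ℝ) ≤ Fintype.card X := by exact_mod_cast Fintype.card_pos
  have hc : |chat ℓ m γ - chat ℓ z γ| ≤ (Fintype.card X : ℝ) * (L + K2) * ‖m - z‖ := by
    refine aux_lip m z _ _ hz.1 L K2 (fun x => ?_) (fun x => hℓLip x (γ x) m z hm.1 hz.1)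
    rw [abs_of_nonneg (hℓ0 _ _ _ hm.1)]
    exact hℓBd _ _ _ hm.1
  have hf : ‖fhat f Pw m γ - fhat f Pw z γ‖ ≤ (Fintype.card X : ℝ) * (1 + K1) * ‖m - z‖ := by
    rw [pi_norm_le_iff_of_nonneg (by positivity)]
    intro y
    refine aux_lip m z (fun x => ker f Pw y x (γ x) m) (fun x => ker f Pw y x (γ x) z) hz.1 1 K1
      (fun x => ?_) (fun x => hpLip x y (γ x) m z hm.1 hz.1)
    rw [abs_of_nonneg (aux_ker_nonneg f Pw hPw0 _ _ _ _)]
    exact aux_ker_le f Pw hPw0 hPw1 _ _ _ _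
  have hP : ∀ ω : Fin n → W, 0 ≤ ∏ i, Pw (ω i) := fun ω => Finset.prod_nonneg fun k _ => hPw0 _
  have htot := aux_tot Pw hPw1 n
  set D := ‖m - z‖ with hD
  set B := (Fintype.card X : ℝ) * (1 + K1) * D with hB
  have hmain : |∑ ω : Fin n → W, (∏ i, Pw (ω i)) * Wf (fbar f m γ ω) - What (fhat f Pw z γ)|
      ≤ K * B + ε + K * ((Fintype.card W : ℝ) * (1 / Real.sqrt n)) := by
    have e : ∑ ω : Fin n → W, (∏ i, Pw (ω i)) * Wf (fbar f m γ ω) - What (fhat f Pw z γ)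
        = ∑ ω : Fin n → W, (∏ i, Pw (ω i)) * (Wf (fbar f m γ ω) - What (fhat f Pw z γ)) := by
      simp_rw [mul_sub, Finset.sum_sub_distrib, ← Finset.sum_mul]
      rw [htot, one_mul]
    rw [e]
    refine (Finset.abs_sum_le_sum_abs _ _).trans ?_
    calc _ ≤ ∑ ω : Fin n → W, (∏ i, Pw (ω i)) *
          ((K * B + ε) + K * ∑ w, |ehat ω w - Pw w|) := by
          refine Finset.sum_le_sum fun ω _ => ?_
          rw [abs_mul, abs_of_nonneg (hP ω)]
          refine mul_le_mul_of_nonneg_left ?_ (hP ω)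
          refine (hWW _ _ (aux_fbar_delta hn f m hm γ ω)
            (aux_fhat_delta f Pw hPw0 hPw1 z hz γ)).trans ?_
          have h1 := norm_sub_le_norm_sub_add_norm_sub (fbar f m γ ω) (fhat f Pw m γ)
            (fhat f Pw z γ)
          have h2 := aux_fbar_fhat f Pw m hm γ ω
          have h3 := mul_le_mul_of_nonneg_left (h1.trans (add_le_add h2 hf)) hK
          linarith
      _ = (K * B + ε) + K * ∑ w, ∑ ω : Fin n → W, (∏ i, Pw (ω i)) * |ehat ω w - Pw w| := by
          rw [Finset.sum_comm]
          have e2 : ∀ ω : Fin n → W, (∏ i, Pw (ω i)) *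
              ((K * B + ε) + K * ∑ w, |ehat ω w - Pw w|) = (∏ i, Pw (ω i)) * (K * B + ε) +
              K * ∑ w, (∏ i, Pw (ω i)) * |ehat ω w - Pw w| := by
            intro ω
            rw [← Finset.mul_sum]
            ring
          rw [Finset.sum_congr rfl (fun ω _ => e2 ω), Finset.sum_add_distrib, ← Finset.sum_mul,
            htot, one_mul, ← Finset.mul_sum]
      _ ≤ (K * B + ε) + K * ∑ w : W, 1 / Real.sqrt n := by
          gcongr with w
          exact aux_dev Pw hPw0 hPw1 n hn w
      _ = _ := by simp
  have hlast : K * ((Fintype.card W : ℝ) * (1 / Real.sqrt n)) ≤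
      K * (Fintype.card X : ℝ) * (Fintype.card W : ℝ) / Real.sqrt n := by
    have : 0 ≤ K * ((Fintype.card W : ℝ) * (1 / Real.sqrt n)) := by positivity
    calc _ ≤ (Fintype.card X : ℝ) * (K * ((Fintype.card W : ℝ) * (1 / Real.sqrt n))) :=
          le_mul_of_one_le_left this hX
      _ = _ := by ring
  rw [add_sub_add_comm]
  refine (abs_add_le _ _).trans ?_
  have : K * B = K * ((Fintype.card X : ℝ) * (1 + K1)) * D := by rw [hB]; ring
  linarith
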